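/- Let R be a commutative ring, r ∈ R, and C a cochain complex of R-modules indexed by ℤ such that multiplication by r is injective on each C^n. Let Ĉ denote the r-adic completion of C: the cochain complex whose n-th component is the inverse limit lim_k (C^n / r^k C^n) along the natural quotient maps, with the induced differentials. Fix i ∈ ℤ and suppose H^i(C) has finite r-torsion: there exists k₀ ∈ ℕ such that every x ∈ H^i(C) with r^k·x = 0 for some k ≥ 1 already satisfies r^{k₀}·x = 0. Then the canonical map H^i(Ĉ) → lim_k H^i(C/r^k C), induced by the projections Ĉ → C/r^k C, is bijective. -/

import Mathlib

/-!
Statement 4: if `H^i(C)` has finite `r`-torsion, then the canonical map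
`H^i(Ĉ) → lim_k H^i(C/r^k C)` from the cohomology of the `r`-adic completion of `C`
to the inverse limit of the cohomologies of the truncations is bijective.

Degrees are indexed by a base integer `j`, with `i = j + 1` (cocycles in degree `j + 1`).
-/

section Setup

variable {R : Type} [CommRing R]

/-- The submodule `r·M` of `r`-multiples of a module `M`. -/
def rMul (r : R) (M : Type) [AddCommGroup M] [Module R M] : Submodule R M :=
  LinearMap.range (r • (LinearMap.id : M →ₗ[R] M))

variable (C : ℤ → Type) [∀ n, AddCommGroup (C n)] [∀ n, Module R (C n)]
variable (d : ∀ n : ℤ, C n →ₗ[R] C (n + 1)) (r : R)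

/-- The components of the quotient complex `C/rC`. -/
abbrev QuotCx (r : R) (n : ℤ) : Type := C n ⧸ rMul r (C n)

/-- The differential of the quotient complex `C/rC`. -/
def dQ (r : R) (n : ℤ) : QuotCx C r n →ₗ[R] QuotCx C r (n + 1) :=
  Submodule.mapQ _ _ (d n) (by
    intro x hx
    obtain ⟨y, rfl⟩ := LinearMap.mem_range.mp hx
    exact Submodule.mem_comap.mpr (LinearMap.mem_range.mpr ⟨d n y, by simp⟩))

/-- The cohomology of a `ℤ`-indexed cochain complex in degree `n + 1`. -/
abbrev Hcoh (X : ℤ → Type) [∀ n, AddCommGroup (X n)] [∀ n, Module R (X n)]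
    (D : ∀ n : ℤ, X n →ₗ[R] X (n + 1)) (n : ℤ) : Type :=
  LinearMap.ker (D (n + 1)) ⧸
    Submodule.comap (LinearMap.ker (D (n + 1))).subtype (LinearMap.range (D n))

/-- The natural transition map `C/r^{k+1} C → C/r^k C` of the `r`-adic tower. -/
def tmap (k : ℕ) (n : ℤ) : QuotCx C (r ^ (k + 1)) n →ₗ[R] QuotCx C (r ^ k) n :=
  Submodule.mapQ _ _ LinearMap.id (by
    intro x hx
    obtain ⟨y, rfl⟩ := LinearMap.mem_range.mp hx
    refine Submodule.mem_comap.mpr (LinearMap.mem_range.mpr ⟨r • y, ?_⟩)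
    simp only [LinearMap.smul_apply, LinearMap.id_apply, smul_smul, ← pow_succ])

/-- The transition maps commute with the differentials of the truncated complexes. -/
theorem tmap_dQ (n : ℤ) (k : ℕ) (q : QuotCx C (r ^ (k + 1)) n) :
    tmap C r k (n + 1) (dQ C d (r ^ (k + 1)) n q) =
      dQ C d (r ^ k) n (tmap C r k n q) := by
  obtain ⟨y, rfl⟩ := Submodule.Quotient.mk_surjective _ q
  simp only [tmap, dQ, Submodule.mapQ_apply, LinearMap.id_apply]

/-- The `n`-th component of the `r`-adic completion `Ĉ` of `C`:
the inverse limit `lim_k C^n/r^k C^n`, realized as compatible sequences. -/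
def compSub (n : ℤ) : Submodule R (∀ k : ℕ, QuotCx C (r ^ k) n) where
  carrier := {g | ∀ k : ℕ, tmap C r k n (g (k + 1)) = g k}
  add_mem' := by
    intro a b ha hb k
    simp only [Pi.add_apply, map_add, ha k, hb k]
  zero_mem' := by
    intro k
    simp
  smul_mem' := by
    intro c a ha k
    simp only [Pi.smul_apply, map_smul, ha k]

theorem mem_compSub {n : ℤ} {g : ∀ k : ℕ, QuotCx C (r ^ k) n} :
    g ∈ compSub C r n ↔ ∀ k : ℕ, tmap C r k n (g (k + 1)) = g k := Iff.rfl

/-- The differential of the completed complex `Ĉ`, acting componentwise. -/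
def dHat (n : ℤ) : ↥(compSub C r n) →ₗ[R] ↥(compSub C r (n + 1)) :=
  LinearMap.restrict (LinearMap.pi fun k => (dQ C d (r ^ k) n).comp (LinearMap.proj k))
    (by
      intro g hg
      rw [mem_compSub]
      intro k
      simp only [LinearMap.pi_apply, LinearMap.comp_apply, LinearMap.proj_apply]
      rw [tmap_dQ C d r n k (g (k + 1)), (mem_compSub C r).mp hg k])

/-- The transition maps of the `r`-adic tower send cocycles to cocycles. -/
def tmapKer (k : ℕ) (n : ℤ) (x : LinearMap.ker (dQ C d (r ^ (k + 1)) (n + 1))) :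
    LinearMap.ker (dQ C d (r ^ k) (n + 1)) :=
  ⟨tmap C r k (n + 1) x.1, by
    rw [LinearMap.mem_ker, ← tmap_dQ C d r (n + 1) k x.1, LinearMap.mem_ker.mp x.2, map_zero]⟩

/-- The projection of a cocycle of the completed complex to a cocycle of `C/r^k C`. -/
def projHatKer (n : ℤ) (k : ℕ) (g : LinearMap.ker (dHat C d r (n + 1))) :
    LinearMap.ker (dQ C d (r ^ k) (n + 1)) :=
  ⟨g.1.1 k, by
    have hg : dHat C d r (n + 1) g.1 = 0 := LinearMap.mem_ker.mp g.2
    have h0 : ((dHat C d r (n + 1) g.1 : ↥(compSub C r (n + 1 + 1))) :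
        ∀ k : ℕ, QuotCx C (r ^ k) (n + 1 + 1)) = 0 := by
      rw [hg]; rfl
    have hk := congrFun h0 k
    have hcalc : ((dHat C d r (n + 1) g.1 : ↥(compSub C r (n + 1 + 1))) :
        ∀ k : ℕ, QuotCx C (r ^ k) (n + 1 + 1)) k = dQ C d (r ^ k) (n + 1) (g.1.1 k) := rfl
    rw [LinearMap.mem_ker, ← hcalc, hk]
    rfl⟩

end Setup

section Helpers

variable {R : Type} [CommRing R]

theorem mem_rMul {r : R} {M : Type} [AddCommGroup M] [Module R M] {x : M} :
    x ∈ rMul r M ↔ ∃ y : M, r • y = x := by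
  simp [rMul]

theorem pow_smul_eq_zero {M : Type} [AddCommGroup M] [Module R M] {r : R}
    (hr : ∀ x : M, r • x = 0 → x = 0) (k : ℕ) {x : M} (hx : r ^ k • x = 0) : x = 0 := by
  induction k with
  | zero => simpa using hx
  | succ k ih => exact ih (hr _ (by rwa [smul_smul, ← pow_succ']))

/-- Two cocycles are cohomologous iff their difference is a coboundary. -/
theorem Hcoh.mk_eq_mk_iff (X : ℤ → Type) [∀ n, AddCommGroup (X n)] [∀ n, Module R (X n)]
    (D : ∀ n : ℤ, X n →ₗ[R] X (n + 1)) (n : ℤ) (x y : LinearMap.ker (D (n + 1))) :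
    (Submodule.Quotient.mk x : Hcoh X D n) = Submodule.Quotient.mk y ↔
      ∃ b : X n, D n b = x.1 - y.1 := by
  rw [Submodule.Quotient.eq, Submodule.mem_comap, LinearMap.mem_range]
  rfl

theorem Hcoh.mk_eq_zero_iff (X : ℤ → Type) [∀ n, AddCommGroup (X n)] [∀ n, Module R (X n)]
    (D : ∀ n : ℤ, X n →ₗ[R] X (n + 1)) (n : ℤ) (x : LinearMap.ker (D (n + 1))) :
    (Submodule.Quotient.mk x : Hcoh X D n) = 0 ↔ ∃ b : X n, D n b = x.1 := by
  rw [Submodule.Quotient.mk_eq_zero, Submodule.mem_comap, LinearMap.mem_range]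
  rfl

variable (C : ℤ → Type) [∀ n, AddCommGroup (C n)] [∀ n, Module R (C n)]
variable (d : ∀ n : ℤ, C n →ₗ[R] C (n + 1)) (r : R)

theorem QuotCx.mk_eq_mk_iff {s : R} {n : ℤ} {x y : C n} :
    (Submodule.Quotient.mk x : QuotCx C s n) = Submodule.Quotient.mk y ↔
      ∃ e : C n, s • e = x - y := by
  rw [Submodule.Quotient.eq, mem_rMul]

theorem mk_mem_compSub {n : ℤ} (c : ℕ → C n) (hc : ∀ k, ∃ e : C n, r ^ k • e = c (k + 1) - c k) :
    (fun k => (Submodule.Quotient.mk (c k) : QuotCx C (r ^ k) n)) ∈ compSub C r n :=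
  fun k => (QuotCx.mk_eq_mk_iff C).2 (hc k)

theorem dHat_apply (n : ℤ) (g : compSub C r n) (k : ℕ) :
    (dHat C d r n g).1 k = dQ C d (r ^ k) n (g.1 k) := rfl

/-- The map `H(C/r^{k+1} C) → H(C/r^k C)` induced by the transition map. -/
def cohTransition (n : ℤ) (k : ℕ) :
    Hcoh (QuotCx C (r ^ (k + 1))) (dQ C d (r ^ (k + 1))) n →ₗ[R]
      Hcoh (QuotCx C (r ^ k)) (dQ C d (r ^ k)) n :=
  Submodule.mapQ _ _
    { toFun := tmapKer C d r k n
      map_add' := fun x y => Subtype.ext (map_add (tmap C r k (n + 1)) x.1 y.1)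
      map_smul' := fun a x => Subtype.ext (map_smul (tmap C r k (n + 1)) a x.1) }
    (by
      rintro x ⟨b, hb⟩
      refine ⟨tmap C r k n b, ?_⟩
      rw [← tmap_dQ, hb]
      rfl)

/-- The map `H(Ĉ) → H(C/r^k C)` induced by the projection. -/
def cohProj (n : ℤ) (k : ℕ) :
    Hcoh (fun n => ↥(compSub C r n)) (dHat C d r) n →ₗ[R]
      Hcoh (QuotCx C (r ^ k)) (dQ C d (r ^ k)) n :=
  Submodule.mapQ _ _
    { toFun := projHatKer C d r n k
      map_add' := fun _ _ => rfl
      map_smul' := fun _ _ => rfl }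
    (by
      rintro x ⟨b, hb⟩
      refine ⟨b.1 k, ?_⟩
      rw [← dHat_apply, hb]
      rfl)

theorem cohTransition_mk (n : ℤ) (k : ℕ) (x : LinearMap.ker (dQ C d (r ^ (k + 1)) (n + 1))) :
    cohTransition C d r n k (Submodule.Quotient.mk x) =
      Submodule.Quotient.mk (tmapKer C d r k n x) := rfl

theorem cohProj_mk (n : ℤ) (k : ℕ) (g : LinearMap.ker (dHat C d r (n + 1))) :
    cohProj C d r n k (Submodule.Quotient.mk g) =
      Submodule.Quotient.mk (projHatKer C d r n k g) := rfl

/-- Every compatible family of classes of the truncations comes from the completion. -/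
theorem exists_cohProj_eq (hdd : ∀ (n : ℤ) (x : C n), d (n + 1) (d n x) = 0) (n : ℤ)
    (h : ∀ k : ℕ, Hcoh (QuotCx C (r ^ k)) (dQ C d (r ^ k)) n)
    (hh : ∀ k, cohTransition C d r n k (h (k + 1)) = h k) :
    ∃ a : Hcoh (fun n => ↥(compSub C r n)) (dHat C d r) n, ∀ k, cohProj C d r n k a = h k := by
  choose z hz using fun k => Submodule.Quotient.mk_surjective _ (h k)
  choose x hx using fun k => Submodule.Quotient.mk_surjective _ (z k).1
  have hstep (k : ℕ) : ∃ b : C n, ∃ e : C (n + 1), r ^ k • e = x (k + 1) - x k - d n b := by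
    have h1 := hh k
    rw [← hz k, ← hz (k + 1), cohTransition_mk, Hcoh.mk_eq_mk_iff] at h1
    obtain ⟨b, hb⟩ := h1
    obtain ⟨b, rfl⟩ := Submodule.Quotient.mk_surjective _ b
    refine ⟨b, (QuotCx.mk_eq_mk_iff C).1 ?_⟩
    rw [Submodule.Quotient.mk_sub, hx k]
    refine Eq.trans ?_ hb.symm
    change _ = tmap C r k (n + 1) (z (k + 1)).1 - (z k).1
    rw [← hx (k + 1)]
    rfl
  choose b e he using hstep
  let y : ℕ → C (n + 1) := fun k => x k - d n (∑ i ∈ Finset.range k, b i)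
  have hy : (fun k => (Submodule.Quotient.mk (y k) : QuotCx C (r ^ k) (n + 1))) ∈
      compSub C r (n + 1) := by
    refine mk_mem_compSub C r y fun k => ⟨e k, ?_⟩
    simp only [y, he, Finset.sum_range_succ, map_add]
    abel
  have hcoc (k : ℕ) : dQ C d (r ^ k) (n + 1) (Submodule.Quotient.mk (y k)) = 0 := by
    have hzk : dQ C d (r ^ k) (n + 1) (Submodule.Quotient.mk (x k)) = 0 := by
      rw [hx k]
      exact (z k).2
    simp only [y]
    rw [Submodule.Quotient.mk_sub, map_sub, hzk, zero_sub, neg_eq_zero]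
    change (Submodule.Quotient.mk (d (n + 1) (d n _)) : QuotCx C (r ^ k) (n + 1 + 1)) = 0
    rw [hdd, Submodule.Quotient.mk_zero]
  refine ⟨Submodule.Quotient.mk ⟨⟨_, hy⟩, LinearMap.mem_ker.2 (Subtype.ext (funext hcoc))⟩,
    fun k => ?_⟩
  rw [cohProj_mk, ← hz k, Hcoh.mk_eq_mk_iff]
  refine ⟨-Submodule.Quotient.mk (∑ i ∈ Finset.range k, b i), ?_⟩
  rw [← hx k, map_neg]
  change _ = (Submodule.Quotient.mk (y k) : QuotCx C (r ^ k) (n + 1)) - _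
  simp only [y]
  rw [Submodule.Quotient.mk_sub, sub_sub_cancel_left]
  rfl

/-- If the `r`-torsion is finite, a class of the completion vanishes as soon as all of its
projections to the truncations do. -/
theorem eq_zero_of_cohProj_eq_zero
    (hdd : ∀ (n : ℤ) (x : C n), d (n + 1) (d n x) = 0)
    (hr : ∀ (n : ℤ) (x : C n), r • x = 0 → x = 0) (n : ℤ) (k₀ : ℕ)
    (htor : ∀ x : Hcoh C d n, (∃ k : ℕ, 1 ≤ k ∧ r ^ k • x = 0) → r ^ k₀ • x = 0)
    (a : Hcoh (fun n => ↥(compSub C r n)) (dHat C d r) n)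
    (ha : ∀ k, cohProj C d r n k a = 0) : a = 0 := by
  obtain ⟨g, rfl⟩ := Submodule.Quotient.mk_surjective _ a
  have hb (k : ℕ) : ∃ b : C n, (Submodule.Quotient.mk (d n b) : QuotCx C (r ^ k) (n + 1)) =
      g.1.1 k := by
    have h1 := ha k
    rw [cohProj_mk, Hcoh.mk_eq_zero_iff] at h1
    obtain ⟨b, hb⟩ := h1
    obtain ⟨b, rfl⟩ := Submodule.Quotient.mk_surjective _ b
    exact ⟨b, hb⟩
  choose b hb using hb
  have htrans (k : ℕ) : tmap C r k (n + 1) (Submodule.Quotient.mk (d n (b (k + 1)))) =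
      g.1.1 k := by
    rw [hb]
    exact g.1.2 k
  have he (k : ℕ) : ∃ e : C (n + 1), r ^ k • e = d n (b (k + 1)) - d n (b k) :=
    (QuotCx.mk_eq_mk_iff C).1 ((htrans k).trans (hb k).symm)
  choose e he using he
  have hcoc (k : ℕ) : d (n + 1) (e k) = 0 := by
    refine pow_smul_eq_zero (hr _) k ?_
    rw [← map_smul, he, map_sub, hdd, hdd, sub_zero]
  have hf (k : ℕ) : ∃ f : C n, d n f = r ^ k₀ • e k := by
    let z : LinearMap.ker (d (n + 1)) := ⟨e k, hcoc k⟩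
    refine (Hcoh.mk_eq_zero_iff C d n (r ^ k₀ • z)).1
      (htor (Submodule.Quotient.mk z) ⟨k + 1, Nat.le_add_left 1 k, ?_⟩)
    refine (Hcoh.mk_eq_zero_iff C d n (r ^ (k + 1) • z)).2 ⟨r • (b (k + 1) - b k), ?_⟩
    change _ = r ^ (k + 1) • e k
    rw [map_smul, map_sub, ← he, smul_smul, pow_succ']
  choose f hf using hf
  let c : ℕ → C n := fun m => b k₀ + ∑ i ∈ Finset.range m, r ^ i • f (k₀ + i)
  have hc : (fun k => (Submodule.Quotient.mk (c k) : QuotCx C (r ^ k) n)) ∈ compSub C r n := by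
    refine mk_mem_compSub C r c fun k => ⟨f (k₀ + k), ?_⟩
    simp only [c, Finset.sum_range_succ]
    abel
  have hdc (m : ℕ) : d n (c m) = d n (b (k₀ + m)) := by
    induction m with
    | zero => simp [c]
    | succ m ih =>
      have hcm : c (m + 1) = c m + r ^ m • f (k₀ + m) := by
        simp only [c, Finset.sum_range_succ, add_assoc]
      rw [hcm, map_add, ih, map_smul, hf, smul_smul, ← pow_add, add_comm m k₀, he,
        add_sub_cancel, add_assoc]
  have hg (l m : ℕ) : (Submodule.Quotient.mk (d n (b (l + m))) : QuotCx C (r ^ m) (n + 1)) =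
      g.1.1 m := by
    induction l with
    | zero => rw [zero_add, hb]
    | succ l ih =>
      rw [← ih, QuotCx.mk_eq_mk_iff]
      refine ⟨r ^ l • e (l + m), ?_⟩
      rw [smul_smul, ← pow_add, add_comm m l, he, add_right_comm]
  refine (Hcoh.mk_eq_zero_iff (fun n => ↥(compSub C r n)) (dHat C d r) n g).2
    ⟨⟨_, hc⟩, Subtype.ext (funext fun m => ?_)⟩
  rw [dHat_apply]
  change (Submodule.Quotient.mk (d n (c m)) : QuotCx C (r ^ m) (n + 1)) = _
  rw [hdc, hg]

end Helpers

/-- Let `C` be a cochain complex of `R`-modules on which multiplication by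
`r` is injective in every degree, and let `Ĉ` be its `r`-adic completion, whose `n`-th
component is `lim_k C^n/r^k C^n`.  Suppose `H^i(C)` (realized at base degree `j`, so
`i = j + 1`) has finite `r`-torsion, with exponent `k₀`.  Then the canonical map
`H^i(Ĉ) → lim_k H^i(C/r^k C)`, induced by the projections `Ĉ → C/r^k C`, is bijective:
it is injective (elements with the same projections agree) and every compatible family
in the inverse limit is in its image. -/
theorem completed_cohomology_bijective_of_finite_torsion
    {R : Type} [CommRing R]
    (C : ℤ → Type) [∀ n, AddCommGroup (C n)] [∀ n, Module R (C n)]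
    (d : ∀ n : ℤ, C n →ₗ[R] C (n + 1))
    (hdd : ∀ (n : ℤ) (x : C n), d (n + 1) (d n x) = 0)
    (r : R)
    (hr : ∀ (n : ℤ) (x : C n), r • x = 0 → x = 0)
    (j : ℤ) (k₀ : ℕ)
    (htor : ∀ x : Hcoh C d j, (∃ k : ℕ, 1 ≤ k ∧ r ^ k • x = 0) → r ^ k₀ • x = 0) :
    ∃ (Hq : ∀ k : ℕ,
        Hcoh (QuotCx C (r ^ (k + 1))) (dQ C d (r ^ (k + 1))) j →ₗ[R]
          Hcoh (QuotCx C (r ^ k)) (dQ C d (r ^ k)) j)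
      (proj : ∀ k : ℕ,
        Hcoh (fun n => ↥(compSub C r n)) (dHat C d r) j →ₗ[R]
          Hcoh (QuotCx C (r ^ k)) (dQ C d (r ^ k)) j),
      (∀ (k : ℕ) (x : LinearMap.ker (dQ C d (r ^ (k + 1)) (j + 1))),
        Hq k (Submodule.Quotient.mk x) = Submodule.Quotient.mk (tmapKer C d r k j x)) ∧
      (∀ (k : ℕ) (g : LinearMap.ker (dHat C d r (j + 1))),
        proj k (Submodule.Quotient.mk g) =
          Submodule.Quotient.mk (projHatKer C d r j k g)) ∧
      (∀ a b : Hcoh (fun n => ↥(compSub C r n)) (dHat C d r) j,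
        (∀ k : ℕ, proj k a = proj k b) → a = b) ∧
      (∀ h : ∀ k : ℕ, Hcoh (QuotCx C (r ^ k)) (dQ C d (r ^ k)) j,
        (∀ k : ℕ, Hq k (h (k + 1)) = h k) →
          ∃ a : Hcoh (fun n => ↥(compSub C r n)) (dHat C d r) j,
            ∀ k : ℕ, proj k a = h k) := by
  refine ⟨cohTransition C d r j, cohProj C d r j, cohTransition_mk C d r j, cohProj_mk C d r j,
    fun a b hab => ?_, exists_cohProj_eq C d r hdd j⟩
  refine sub_eq_zero.1 (eq_zero_of_cohProj_eq_zero C d r hdd hr j k₀ htor _ fun k => ?_)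
  rw [map_sub, hab k, sub_self]
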